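/- The operators Q_q and C_q = (1 − P_q)/2 − Q_q/(2r) satisfy Q_q ∘ C_q = C_q ∘ Q_q = 0 on V ⊗ V. -/

import Mathlib

open scoped BigOperators

noncomputable section

/-- The index set `I = {-r, …, -1, 1, …, r}` as a subtype of `ℤ`. -/
abbrev SIdx (r : ℕ) : Type := {i : ℤ // i ∈ (Finset.Icc (-(r : ℤ)) (r : ℤ)).erase 0}

instance (r : ℕ) : Neg (SIdx r) :=
  ⟨fun i => ⟨-i.1, by
    obtain ⟨h1, h2⟩ := Finset.mem_erase.mp i.2
    rw [Finset.mem_Icc] at h2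
    exact Finset.mem_erase.mpr ⟨neg_ne_zero.mpr h1, Finset.mem_Icc.mpr (by omega)⟩⟩⟩

/-- The sign `ε_i`: `1` for `i > 0` and `-1` for `i < 0`, as an element of `K`. -/
def sgn (K : Type*) [Field K] {r : ℕ} (i : SIdx r) : K := if 0 < i.1 then 1 else -1

/-- A symplectic parameter family `q = (q_{ij}, q_i)`: nonzero scalars with
`q_{ij} = q_{ji}⁻¹`, `q_{ii} = 1`, `q_{-i} = q_i⁻¹` and `q_{-i,j} = q_{ij}⁻¹ q_j²`. -/
structure SympParam (K : Type*) [Field K] (r : ℕ) where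
  qm : SIdx r → SIdx r → K
  qv : SIdx r → K
  qm_ne : ∀ i j, qm i j ≠ 0
  qv_ne : ∀ i, qv i ≠ 0
  qm_symm : ∀ i j, qm i j = (qm j i)⁻¹
  qm_diag : ∀ i, qm i i = 1
  qv_neg : ∀ i, qv (-i) = (qv i)⁻¹
  qm_neg : ∀ i j, qm (-i) j = (qm i j)⁻¹ * (qv j) ^ 2

variable {K : Type*} [Field K] [CharZero K] {r : ℕ}

/-- The operator `P_q` on `V ⊗ V`, where `V = SIdx r → K` and `V ⊗ V` is realized as
`(SIdx r × SIdx r) → K` with basis vector `e l ⊗ e m = Pi.single (l, m) 1`.  It sends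
`e l ⊗ e m ↦ q_{lm} • (e m ⊗ e l)`. -/
def Pq (q : SympParam K r) : Module.End K (SIdx r × SIdx r → K) where
  toFun f := fun p => q.qm p.2 p.1 * f (p.2, p.1)
  map_add' f g := by funext p; simp [mul_add]
  map_smul' c f := by funext p; simp [smul_eq_mul]; ring

/-- The operator `Q_q` on `V ⊗ V`: it sends
`e l ⊗ e m ↦ δ_{m,-l} ε_l q_l⁻¹ • ∑ i, ε_i q_i • (e i ⊗ e (-i))`. -/
def Qq (q : SympParam K r) : Module.End K (SIdx r × SIdx r → K) where
  toFun f := fun p =>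
    if p.2 = -p.1 then
      sgn K p.1 * q.qv p.1 * ∑ l : SIdx r, sgn K l * (q.qv l)⁻¹ * f (l, -l)
    else 0
  map_add' f g := by
    funext p
    by_cases h : p.2 = -p.1 <;> simp [h, mul_add, Finset.sum_add_distrib]
  map_smul' c f := by
    funext p
    by_cases h : p.2 = -p.1 <;>
      simp only [h, if_true, if_false, Pi.smul_apply, smul_eq_mul, RingHom.id_apply,
        Finset.mul_sum, mul_zero]
    · exact Finset.sum_congr rfl fun l _ => by ring

/-- The idempotent `C_q = (1 − P_q)/2 − Q_q/(2r)` on `V ⊗ V`. -/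
def Cq (q : SympParam K r) : Module.End K (SIdx r × SIdx r → K) :=
  (2 : K)⁻¹ • (1 - Pq q) - (2 * (r : K))⁻¹ • Qq q

lemma SIdx.neg_neg (i : SIdx r) : -(-i) = i :=
  Subtype.ext (_root_.neg_neg i.1)

lemma card_SIdx (r : ℕ) : Fintype.card (SIdx r) = 2 * r := by
  rw [Fintype.card_coe, Finset.card_erase_of_mem (by simp), Int.card_Icc]
  omega

lemma sgn_neg {F : Type*} [Field F] (i : SIdx r) : sgn F (-i) = -sgn F i := by
  have h : i.1 ≠ 0 := (Finset.mem_erase.mp i.2).1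
  have hn : (-i).1 = -i.1 := rfl
  rcases lt_or_gt_of_ne h with h | h
  · simp [sgn, hn, h, h.not_gt]
  · simp [sgn, hn, h, h.le]

lemma sgn_mul_self {F : Type*} [Field F] (i : SIdx r) : sgn F i * sgn F i = 1 := by
  unfold sgn; split_ifs <;> simp

lemma SympParam.qm_neg_self {F : Type*} [Field F] (q : SympParam F r) (i : SIdx r) :
    q.qm (-i) i = q.qv i ^ 2 := by
  simp [q.qm_neg, q.qm_diag]

lemma Qq_mul_Qq (q : SympParam K r) : Qq q * Qq q = (2 * (r : K)) • Qq q := by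
  have key : ∀ S : K, ∑ l : SIdx r, sgn K l * (q.qv l)⁻¹ * (sgn K l * q.qv l * S)
      = 2 * (r : K) * S := by
    intro S
    have h : ∀ l : SIdx r, sgn K l * (q.qv l)⁻¹ * (sgn K l * q.qv l * S) = S := fun l => by
      calc _ = (sgn K l * sgn K l) * ((q.qv l)⁻¹ * q.qv l) * S := by ring
        _ = S := by rw [sgn_mul_self, inv_mul_cancel₀ (q.qv_ne l), one_mul, one_mul]
    simp only [h, Finset.sum_const, Finset.card_univ, card_SIdx, nsmul_eq_mul]
    push_cast
    rfl
  refine LinearMap.ext fun f => funext fun p => ?_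
  simp only [Qq, Module.End.mul_apply, LinearMap.smul_apply,
    LinearMap.coe_mk, AddHom.coe_mk, Pi.smul_apply, smul_eq_mul, if_true, key]
  split_ifs <;> ring

lemma Pq_mul_Qq (q : SympParam K r) : Pq q * Qq q = -Qq q := by
  refine LinearMap.ext fun f => funext fun p => ?_
  obtain ⟨i, j⟩ := p
  simp only [Pq, Qq, Module.End.mul_apply, LinearMap.neg_apply, LinearMap.coe_mk, AddHom.coe_mk,
    Pi.neg_apply]
  by_cases h : j = -i
  · subst h
    simp only [SIdx.neg_neg, if_true, q.qm_neg_self, sgn_neg, q.qv_neg]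
    field_simp [q.qv_ne i]
  · have h' : i ≠ -j := fun e => h (by rw [e, SIdx.neg_neg])
    simp [h, h']

lemma Qq_mul_Pq (q : SympParam K r) : Qq q * Pq q = -Qq q := by
  refine LinearMap.ext fun f => funext fun p => ?_
  have key : ∑ l : SIdx r, sgn K l * (q.qv l)⁻¹ * (q.qm (-l) l * f (-l, l))
      = -∑ l : SIdx r, sgn K l * (q.qv l)⁻¹ * f (l, -l) := by
    rw [← Finset.sum_neg_distrib]
    refine Fintype.sum_bijective (fun l : SIdx r => -l)
      (Function.Involutive.bijective SIdx.neg_neg) _ _ fun l => ?_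
    simp only [SIdx.neg_neg, q.qm_neg_self, sgn_neg, q.qv_neg]
    field_simp [q.qv_ne l]
  simp only [Pq, Qq, Module.End.mul_apply, LinearMap.neg_apply, LinearMap.coe_mk, AddHom.coe_mk,
    Pi.neg_apply, key]
  split_ifs <;> ring

/-- `Q_q ∘ C_q = C_q ∘ Q_q = 0` on `V ⊗ V`. -/
theorem Qq_Cq_zero (hr : 1 ≤ r) (q : SympParam K r) :
    Qq q ∘ₗ Cq q = 0 ∧ Cq q ∘ₗ Qq q = 0 := by
  have hr' : (2 * (r : K)) ≠ 0 := mul_ne_zero two_ne_zero (by exact_mod_cast (by omega : r ≠ 0))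
  have half : (2 : K)⁻¹ • (Qq q + Qq q) = Qq q := by
    rw [← two_smul K (Qq q), inv_smul_smul₀ two_ne_zero]
  rw [← Module.End.mul_eq_comp, ← Module.End.mul_eq_comp, Cq]
  constructor
  · rw [mul_sub, mul_smul_comm, mul_smul_comm, mul_sub, mul_one, Qq_mul_Pq, Qq_mul_Qq,
      sub_neg_eq_add, half, inv_smul_smul₀ hr', sub_self]
  · rw [sub_mul, smul_mul_assoc, smul_mul_assoc, sub_mul, one_mul, Pq_mul_Qq, Qq_mul_Qq,
      sub_neg_eq_add, half, inv_smul_smul₀ hr', sub_self]
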